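/- Let ℓ, u be reals with 0 ≤ ℓ < u, let n ≥ 2 be an integer, and let p > 1. If ξ ∈ D is a stationary point of the volume function V_p (i.e., the gradient of V_p, as a function of (ξ_1, …, ξ_{n−1}), vanishes at ξ), then the Hessian matrix of V_p at ξ is positive definite; in particular, every stationary point of V_p on D is a strict local minimizer. -/

import Mathlib

/-- The full sequence of linearization points: `ξ 0 = ℓ`, `ξ n = u`,
interior coordinates given by `x`. -/
noncomputable def xiSeq (l u : ℝ) (n : ℕ) (x : Fin (n - 1) → ℝ) (i : ℕ) : ℝ :=
  if h : 0 < i ∧ i < n then x ⟨i - 1, by omega⟩ else if i = 0 then l else u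

/-- The open domain `D = {ℓ < ξ₁ < ⋯ < ξ_{n-1} < u}`. -/
def domD (l u : ℝ) (n : ℕ) : Set (Fin (n - 1) → ℝ) :=
  {x | ∀ i < n, xiSeq l u n x i < xiSeq l u n x (i + 1)}

/-- The volume function `V_p` of the perspective relaxation of the piecewise-linear
under-estimator of `x^p` with linearization points `ℓ = ξ₀ < ξ₁ < ⋯ < ξ_n = u`. -/
noncomputable def Vp (l u p : ℝ) (n : ℕ) (x : Fin (n - 1) → ℝ) : ℝ :=
  -((p - 1) ^ 2 / (6 * p)) * ∑ i ∈ Finset.Icc 1 n,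
      (xiSeq l u n x (i - 1)) ^ (p - 1) * (xiSeq l u n x i) ^ (p - 1)
        * (xiSeq l u n x i - xiSeq l u n x (i - 1)) ^ 2
        / ((xiSeq l u n x i) ^ (p - 1) - (xiSeq l u n x (i - 1)) ^ (p - 1))
  + ((p - 1) / (6 * p)) * (u ^ (p + 1) - l ^ (p + 1)) - (1 / 6) * (u ^ p * l - u * l ^ p)


section Helpers

open Filter Topology

/-- Partial derivative in the first variable of `(b-a)^2/(a^(-q)-b^(-q))`. -/
noncomputable def eFa (q a b : ℝ) : ℝ :=
  -(2 * (b - a)) / (a ^ (-q) - b ^ (-q))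
    + (b - a) ^ 2 * (q * a ^ (-q) / a) / (a ^ (-q) - b ^ (-q)) ^ 2

/-- Partial derivative in the second variable. -/
noncomputable def eFb (q a b : ℝ) : ℝ :=
  (2 * (b - a)) / (a ^ (-q) - b ^ (-q))
    - (b - a) ^ 2 * (q * b ^ (-q) / b) / (a ^ (-q) - b ^ (-q)) ^ 2

/-- Mixed second partial derivative. -/
noncomputable def eFab (q a b : ℝ) : ℝ :=
  2 * ((a ^ (-q) - b ^ (-q)) - (b - a) * (q * b ^ (-q) / b))
    * ((b - a) * (q * a ^ (-q) / a) - (a ^ (-q) - b ^ (-q))) / (a ^ (-q) - b ^ (-q)) ^ 3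

/-- The summand. -/
noncomputable def eT (q a b : ℝ) : ℝ := a ^ q * b ^ q * (b - a) ^ 2 / (b ^ q - a ^ q)

lemma g_pos {q a b : ℝ} (hq : 0 < q) (ha : 0 < a) (hab : a < b) : 0 < a ^ (-q) - b ^ (-q) :=
  sub_pos.2 (Real.rpow_lt_rpow_of_neg ha hab (by linarith))

lemma eT_eq {q a b : ℝ} (hq : 0 < q) (ha : 0 < a) (hab : a < b) :
    eT q a b = (b - a) ^ 2 / (a ^ (-q) - b ^ (-q)) := by
  have hb := ha.trans hab
  have h1 : 0 < a ^ q := Real.rpow_pos_of_pos ha q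
  have h2 : 0 < b ^ q := Real.rpow_pos_of_pos hb q
  have h3 : a ^ q < b ^ q := Real.rpow_lt_rpow ha.le hab hq
  have h4 : b ^ q - a ^ q ≠ 0 := by linarith
  unfold eT
  rw [Real.rpow_neg ha.le, Real.rpow_neg hb.le]
  have h5 : (a ^ q)⁻¹ - (b ^ q)⁻¹ = (b ^ q - a ^ q) / (a ^ q * b ^ q) := by
    field_simp
  rw [h5]
  field_simp

lemma hasDerivAt_pw {q a x t : ℝ} (ha : 0 < a + t * x) :
    HasDerivAt (fun t : ℝ => (a + t * x) ^ (-q)) (-(q * (a + t * x) ^ (-q) / (a + t * x)) * x) t := by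
  have h : HasDerivAt (fun t : ℝ => a + t * x) x t := by
    simpa using ((hasDerivAt_id t).mul_const x).const_add a
  have := h.rpow_const (p := -q) (Or.inl ha.ne')
  convert this using 1
  rw [Real.rpow_sub_one ha.ne']
  ring

lemma hasDerivAt_eT {q a b x y t : ℝ} (hq : 0 < q) (ha : 0 < a + t * x)
    (hab : a + t * x < b + t * y) :
    HasDerivAt (fun t : ℝ => eT q (a + t * x) (b + t * y))
      (eFa q (a + t * x) (b + t * y) * x + eFb q (a + t * x) (b + t * y) * y) t := by
  have hb := ha.trans hab
  have hg := g_pos hq ha hab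
  have la : HasDerivAt (fun t : ℝ => a + t * x) x t := by
    simpa using ((hasDerivAt_id t).mul_const x).const_add a
  have lb : HasDerivAt (fun t : ℝ => b + t * y) y t := by
    simpa using ((hasDerivAt_id t).mul_const y).const_add b
  have key := ((lb.fun_sub la).fun_pow 2).fun_div
    ((hasDerivAt_pw (q := q) ha).fun_sub (hasDerivAt_pw (q := q) hb)) hg.ne'
  have hev : (fun t : ℝ => eT q (a + t * x) (b + t * y)) =ᶠ[𝓝 t]
      (fun t : ℝ => ((b + t * y) - (a + t * x)) ^ 2 /
        ((a + t * x) ^ (-q) - (b + t * y) ^ (-q))) := by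
    have e1 := la.continuousAt.eventually (lt_mem_nhds ha)
    have e2 := (lb.continuousAt.sub la.continuousAt).eventually
      (lt_mem_nhds (sub_pos.2 hab))
    filter_upwards [e1, e2] with s h1 h2
    exact eT_eq hq h1 (by simpa using h2)
  refine (key.congr_of_eventuallyEq hev).congr_deriv ?_
  unfold eFa eFb
  generalize (a + t * x) ^ (-q) = A at *
  generalize (b + t * y) ^ (-q) = B at *
  generalize a + t * x = a at *
  generalize b + t * y = b at *
  have := hg.ne'
  field_simp
  ring

lemma hasDerivAt_eF {q a b x y : ℝ} (hq : 0 < q) (ha : 0 < a) (hab : a < b) :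
    HasDerivAt (fun t : ℝ =>
        eFa q (a + t * x) (b + t * y) * x + eFb q (a + t * x) (b + t * y) * y)
      ((q + 1) * (eFa q a b * (x ^ 2 / a) + eFb q a b * (y ^ 2 / b))
        - eFab q a b * (b * x - a * y) ^ 2 / (a * b)) 0 := by
  have hb := ha.trans hab
  have hg := g_pos hq ha hab
  have la : HasDerivAt (fun t : ℝ => a + t * x) x 0 := by
    simpa using ((hasDerivAt_id (0:ℝ)).mul_const x).const_add a
  have lb : HasDerivAt (fun t : ℝ => b + t * y) y 0 := by
    simpa using ((hasDerivAt_id (0:ℝ)).mul_const y).const_add b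
  have pa := hasDerivAt_pw (q := q) (a := a) (x := x) (t := 0) (by simpa using ha)
  have pb := hasDerivAt_pw (q := q) (a := b) (x := y) (t := 0) (by simpa using hb)
  have dg := pa.fun_sub pb
  have hg0 : (a + 0 * x) ^ (-q) - (b + 0 * y) ^ (-q) ≠ 0 := by simpa using hg.ne'
  have hD := lb.fun_sub la
  have ka := ((hD.const_mul 2).fun_neg.fun_div dg hg0).fun_add
    (((hD.fun_pow 2).fun_mul ((pa.const_mul q).fun_div la (by simpa using ha.ne'))).fun_div
      (dg.fun_pow 2) (pow_ne_zero 2 hg0))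
  have kb := ((hD.const_mul 2).fun_div dg hg0).fun_sub
    (((hD.fun_pow 2).fun_mul ((pb.const_mul q).fun_div lb (by simpa using hb.ne'))).fun_div
      (dg.fun_pow 2) (pow_ne_zero 2 hg0))
  have key := (ka.mul_const x).fun_add (kb.mul_const y)
  unfold eFa eFb eFab
  refine key.congr_deriv ?_
  simp only [zero_mul, add_zero]
  generalize a ^ (-q) = A at *
  generalize b ^ (-q) = B at *
  have := hg.ne'
  have := ha.ne'
  have := hb.ne'
  obtain ⟨g, rfl⟩ : ∃ g, A = g + B := ⟨A - B, by ring⟩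
  simp only [add_sub_cancel_right] at *
  field_simp
  ring

lemma eFab_pos {q a b : ℝ} (hq : 0 < q) (ha : 0 < a) (hab : a < b) : 0 < eFab q a b := by
  have hb := ha.trans hab
  have hg := g_pos hq ha hab
  have hA : 0 < a ^ (-q) := Real.rpow_pos_of_pos ha _
  have hB : 0 < b ^ (-q) := Real.rpow_pos_of_pos hb _
  have bern : ∀ c d : ℝ, 0 < c → 0 < d → c ≠ d →
      c ^ (-q) + (-(q * c ^ (-q) / c)) * (d - c) < d ^ (-q) := by
    intro c d hc hd hcd
    have hr : 0 < d / c := div_pos hd hc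
    have hr1 : d / c ≠ 1 := fun h => hcd ((div_eq_one_iff_eq hc.ne').1 h).symm
    have e1 := Real.log_lt_sub_one_of_pos hr hr1
    have e2 := Real.add_one_le_exp (Real.log (d / c) * (-q))
    rw [← Real.rpow_def_of_pos hr, Real.div_rpow hd.le hc.le] at e2
    have hC : 0 < c ^ (-q) := Real.rpow_pos_of_pos hc _
    have e3 : 1 - q * (d / c - 1) < d ^ (-q) / c ^ (-q) := by nlinarith
    rw [lt_div_iff₀ hC] at e3
    calc _ = (1 - q * (d / c - 1)) * c ^ (-q) := by field_simp; ring
      _ < _ := e3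
  have h1 := bern a b ha hb hab.ne
  have h2 := bern b a hb ha hab.ne'
  unfold eFab
  have i1 : 0 < (a ^ (-q) - b ^ (-q)) - (b - a) * (q * b ^ (-q) / b) := by linarith
  have i2 : 0 < (b - a) * (q * a ^ (-q) / a) - (a ^ (-q) - b ^ (-q)) := by linarith
  positivity

lemma strict_min_of_hessian {E : Type*} [NormedAddCommGroup E] [NormedSpace ℝ E]
    [FiniteDimensional ℝ E] (f : E → ℝ) (x : E)
    (hd : ∀ᶠ y in 𝓝 x, DifferentiableAt ℝ f y)
    (h2 : DifferentiableAt ℝ (fderiv ℝ f) x) (h0 : fderiv ℝ f x = 0)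
    (hpos : ∀ v : E, v ≠ 0 → 0 < fderiv ℝ (fderiv ℝ f) x v v) :
    ∃ ε > (0 : ℝ), ∀ y : E, y ≠ x → ‖y - x‖ < ε → f x < f y := by
  set H := fderiv ℝ (fderiv ℝ f) x with hH
  have hcont : Continuous (fun v : E => H v v) := by fun_prop
  obtain ⟨c, hc, hcs⟩ := (isCompact_sphere (0 : E) 1).exists_forall_le' hcont.continuousOn
    (a := 0) (fun b hb => hpos b (by
      rintro rfl
      simp at hb))
  have hcv : ∀ v : E, c * ‖v‖ ^ 2 ≤ H v v := by
    intro v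
    by_cases hv : v = 0
    · simp [hv]
    have hn : 0 < ‖v‖ := norm_pos_iff.2 hv
    have := hcs (‖v‖⁻¹ • v) (by simp [norm_smul, hn.ne'])
    simp only [map_smul, ContinuousLinearMap.smul_apply, smul_eq_mul] at this
    have e : H v v = ‖v‖ ^ 2 * (‖v‖⁻¹ * (‖v‖⁻¹ * H v v)) := by field_simp
    rw [e, mul_comm c]
    exact mul_le_mul_of_nonneg_left this (by positivity)
  have ho := h2.hasFDerivAt.isLittleO.bound (half_pos hc)
  obtain ⟨ε, hε, hb⟩ := Metric.eventually_nhds_iff.1 (hd.and ho)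
  refine ⟨ε, hε, fun y hy hyx => ?_⟩
  set v := y - x with hv
  have hv0 : 0 < ‖v‖ := norm_pos_iff.2 (sub_ne_zero.2 hy)
  have hin : ∀ t ∈ Set.Icc (0 : ℝ) 1, dist (x + t • v) x < ε := by
    intro t ht
    rw [dist_eq_norm, add_sub_cancel_left, norm_smul, Real.norm_of_nonneg ht.1]
    nlinarith [ht.2]
  have hder : ∀ t ∈ Set.Icc (0 : ℝ) 1,
      HasDerivAt (fun t : ℝ => f (x + t • v)) (fderiv ℝ f (x + t • v) v) t := by
    intro t ht
    have l : HasDerivAt (fun t : ℝ => x + t • v) v t := by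
      simpa using ((hasDerivAt_id t).smul_const v).const_add x
    exact (hb (hin t ht)).1.hasFDerivAt.comp_hasDerivAt t l
  have hmono : StrictMonoOn (fun t : ℝ => f (x + t • v)) (Set.Icc 0 1) := by
    refine strictMonoOn_of_deriv_pos (convex_Icc 0 1)
      (fun t ht => (hder t ht).continuousAt.continuousWithinAt) ?_
    intro t ht
    rw [interior_Icc] at ht
    have ht' : t ∈ Set.Icc (0 : ℝ) 1 := ⟨ht.1.le, ht.2.le⟩
    rw [(hder t ht').deriv]
    have hbd := (hb (hin t ht')).2
    rw [h0, sub_zero, add_sub_cancel_left] at hbd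
    have h3 := ContinuousLinearMap.le_of_opNorm_le _ hbd v
    have h4 := (abs_le.1 (by simpa using h3 :
      |fderiv ℝ f (x + t • v) v - t * H v v| ≤ _)).1
    rw [norm_smul, Real.norm_of_nonneg ht.1.le] at h4
    have h5 := hcv v
    have h6 : 0 < t * (c * ‖v‖ ^ 2) := by have := ht.1; positivity
    nlinarith [mul_le_mul_of_nonneg_left h5 ht.1.le]
  have := hmono (Set.left_mem_Icc.2 zero_le_one) (Set.right_mem_Icc.2 zero_le_one) zero_lt_one
  simpa [hv] using this

lemma xiSeq_line (l u : ℝ) (n : ℕ) (x v : Fin (n - 1) → ℝ) (t : ℝ) (i : ℕ) :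
    xiSeq l u n (x + t • v) i = xiSeq l u n x i + t * xiSeq 0 0 n v i := by
  unfold xiSeq
  split_ifs <;> simp

lemma xiSeq_contDiff (l u : ℝ) (n : ℕ) (i : ℕ) :
    ContDiff ℝ 2 (fun x : Fin (n - 1) → ℝ => xiSeq l u n x i) := by
  unfold xiSeq
  split_ifs <;> fun_prop

lemma Vp_eq (l u p : ℝ) (n : ℕ) : Vp l u p n = fun x =>
    -((p - 1) ^ 2 / (6 * p)) * ∑ i ∈ Finset.Icc 1 n,
      eT (p - 1) (xiSeq l u n x (i - 1)) (xiSeq l u n x i)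
  + ((p - 1) / (6 * p)) * (u ^ (p + 1) - l ^ (p + 1)) - (1 / 6) * (u ^ p * l - u * l ^ p) := rfl

lemma xiSeq_zero (l u : ℝ) (n : ℕ) (x : Fin (n - 1) → ℝ) : xiSeq l u n x 0 = l := by
  simp [xiSeq]

lemma xiSeq_pos {l u : ℝ} (hl : 0 ≤ l) {n : ℕ} {x : Fin (n - 1) → ℝ} (hx : x ∈ domD l u n) :
    ∀ i, i ≤ n → 0 < i → 0 < xiSeq l u n x i := by
  have : ∀ i, i ≤ n → 0 ≤ xiSeq l u n x i ∧ (0 < i → 0 < xiSeq l u n x i) := by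
    intro i
    induction i with
    | zero => intro _; simpa [xiSeq_zero] using hl
    | succ k ih =>
      intro hk
      have h1 := (ih (by omega)).1
      have h2 : xiSeq l u n x k < xiSeq l u n x (k + 1) := hx k (by omega)
      exact ⟨by linarith, fun _ => by linarith⟩
  exact fun i hi h => (this i hi).2 h

lemma eT_zero {q : ℝ} (hq : 0 < q) (b : ℝ) : eT q 0 b = 0 := by
  simp [eT, Real.zero_rpow hq.ne']

/-- Either the left endpoint of edge `i` is positive, or `i = 1` and `l = 0`. -/
lemma edge_cases {l u : ℝ} (hl : 0 ≤ l) {n : ℕ} {x : Fin (n - 1) → ℝ} (hx : x ∈ domD l u n)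
    {i : ℕ} (hi : i ∈ Finset.Icc 1 n) :
    (0 < xiSeq l u n x (i - 1) ∧ xiSeq l u n x (i - 1) < xiSeq l u n x i) ∨ (i = 1 ∧ l = 0) := by
  rw [Finset.mem_Icc] at hi
  have h1 := hx (i - 1) (by omega)
  rw [Nat.sub_add_cancel hi.1] at h1
  by_cases h : i = 1
  · subst h
    rcases hl.eq_or_lt with h | h
    · exact Or.inr ⟨rfl, h.symm⟩
    · exact Or.inl ⟨by simpa [xiSeq_zero] using h, h1⟩
  · exact Or.inl ⟨xiSeq_pos hl hx (i - 1) (by omega) (by omega), h1⟩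

lemma Vp_contDiffAt {l u p : ℝ} (hl : 0 ≤ l) (hp : 1 < p) {n : ℕ} {x : Fin (n - 1) → ℝ}
    (hx : x ∈ domD l u n) : ContDiffAt ℝ 2 (Vp l u p n) x := by
  have hq : 0 < p - 1 := by linarith
  rw [Vp_eq]
  refine ContDiffAt.sub (ContDiffAt.add (contDiffAt_const.mul ?_) contDiffAt_const) contDiffAt_const
  refine ContDiffAt.sum fun i hi => ?_
  rcases edge_cases hl hx hi with ⟨ha, hab⟩ | ⟨rfl, rfl⟩
  · have c1 := (xiSeq_contDiff l u n (i - 1)).contDiffAt (x := x)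
    have c2 := (xiSeq_contDiff l u n i).contDiffAt (x := x)
    have r1 := c1.rpow_const_of_ne (p := p - 1) ha.ne'
    have r2 := c2.rpow_const_of_ne (p := p - 1) (ha.trans hab).ne'
    exact ((r1.mul r2).mul ((c2.sub c1).pow 2)).div (r2.sub r1)
      (sub_pos.2 (Real.rpow_lt_rpow ha.le hab hq)).ne'
  · simp only [Nat.sub_self, xiSeq_zero, eT_zero hq]
    exact contDiffAt_const

open Classical in
/-- Directional derivative of edge `i` at `x` in direction `v`. -/
noncomputable def eD (l u q : ℝ) (n : ℕ) (v x : Fin (n - 1) → ℝ) (i : ℕ) : ℝ :=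
  if i = 1 ∧ l = 0 then 0 else
    eFa q (xiSeq l u n x (i - 1)) (xiSeq l u n x i) * xiSeq 0 0 n v (i - 1)
    + eFb q (xiSeq l u n x (i - 1)) (xiSeq l u n x i) * xiSeq 0 0 n v i

lemma line_hasDerivAt {E : Type*} [NormedAddCommGroup E] [NormedSpace ℝ E] (x v : E) (t : ℝ) :
    HasDerivAt (fun t : ℝ => x + t • v) v t := by
  simpa using ((hasDerivAt_id t).smul_const v).const_add x

lemma domD_isOpen (l u : ℝ) (n : ℕ) : IsOpen (domD l u n) := by
  have : domD l u n = ⋂ i ∈ Finset.range n,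
      {x | xiSeq l u n x i < xiSeq l u n x (i + 1)} := by
    ext x; simp [domD]
  rw [this]
  exact isOpen_biInter_finset fun i _ =>
    isOpen_lt (xiSeq_contDiff l u n i).continuous (xiSeq_contDiff l u n (i + 1)).continuous

lemma fderiv_Vp {l u p : ℝ} (hl : 0 ≤ l) (hp : 1 < p) {n : ℕ} {x : Fin (n - 1) → ℝ}
    (hx : x ∈ domD l u n) (v : Fin (n - 1) → ℝ) :
    fderiv ℝ (Vp l u p n) x v =
      -((p - 1) ^ 2 / (6 * p)) * ∑ i ∈ Finset.Icc 1 n, eD l u (p - 1) n v x i := by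
  have hq : 0 < p - 1 := by linarith
  have hd : DifferentiableAt ℝ (Vp l u p n) x :=
    (Vp_contDiffAt hl hp hx).differentiableAt (by norm_num)
  have h1 : HasDerivAt (fun t : ℝ => Vp l u p n (x + t • v)) (fderiv ℝ (Vp l u p n) x v) 0 := by
    have hd' : HasFDerivAt (Vp l u p n) (fderiv ℝ (Vp l u p n) x) (x + (0 : ℝ) • v) := by
      simpa using hd.hasFDerivAt
    exact hd'.comp_hasDerivAt (0 : ℝ) (line_hasDerivAt x v 0)
  refine h1.unique ?_
  simp only [Vp_eq]
  refine HasDerivAt.sub_const _ (HasDerivAt.add_const _ (HasDerivAt.const_mul _ ?_))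
  refine HasDerivAt.fun_sum fun i hi => ?_
  by_cases hc : i = 1 ∧ l = 0
  · rw [eD, if_pos hc]
    obtain ⟨rfl, rfl⟩ := hc
    simp only [Nat.sub_self, xiSeq_zero, eT_zero hq]
    exact hasDerivAt_const _ _
  · obtain ⟨ha, hab⟩ := (edge_cases hl hx hi).resolve_right hc
    rw [eD, if_neg hc]
    simp only [xiSeq_line]
    have := hasDerivAt_eT (q := p - 1) (a := xiSeq l u n x (i - 1)) (b := xiSeq l u n x i)
      (x := xiSeq 0 0 n v (i - 1)) (y := xiSeq 0 0 n v i) (t := 0) hq (by simpa using ha)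
      (by simpa using hab)
    simpa only [zero_mul, add_zero] using this

open Classical in
/-- The remainder of the second derivative on edge `i`. -/
noncomputable def eR (l u q : ℝ) (n : ℕ) (v x : Fin (n - 1) → ℝ) (i : ℕ) : ℝ :=
  if i = 1 ∧ l = 0 then 0 else
    eFab q (xiSeq l u n x (i - 1)) (xiSeq l u n x i)
      * (xiSeq l u n x i * xiSeq 0 0 n v (i - 1) - xiSeq l u n x (i - 1) * xiSeq 0 0 n v i) ^ 2
      / (xiSeq l u n x (i - 1) * xiSeq l u n x i)

lemma xiSeq_sq_div (l u : ℝ) (n : ℕ) (x v : Fin (n - 1) → ℝ) (i : ℕ) :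
    xiSeq 0 0 n (fun j => v j ^ 2 / x j) i = xiSeq 0 0 n v i ^ 2 / xiSeq l u n x i := by
  unfold xiSeq
  split_ifs <;> simp

lemma hess_Vp {l u p : ℝ} (hl : 0 ≤ l) (hp : 1 < p) {n : ℕ} {x : Fin (n - 1) → ℝ}
    (hx : x ∈ domD l u n) (hstat : fderiv ℝ (Vp l u p n) x = 0) (v : Fin (n - 1) → ℝ) :
    fderiv ℝ (fderiv ℝ (Vp l u p n)) x v v =
      ((p - 1) ^ 2 / (6 * p)) * ∑ i ∈ Finset.Icc 1 n, eR l u (p - 1) n v x i := by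
  have hq : 0 < p - 1 := by linarith
  have hd : DifferentiableAt ℝ (fderiv ℝ (Vp l u p n)) x :=
    ((Vp_contDiffAt hl hp hx).fderiv_right (m := 1) (by norm_num)).differentiableAt (by norm_num)
  have h1 : HasDerivAt (fun t : ℝ => fderiv ℝ (Vp l u p n) (x + t • v) v)
      (fderiv ℝ (fderiv ℝ (Vp l u p n)) x v v) 0 := by
    have hd' : HasFDerivAt (fderiv ℝ (Vp l u p n)) (fderiv ℝ (fderiv ℝ (Vp l u p n)) x)
        (x + (0 : ℝ) • v) := by
      simpa using hd.hasFDerivAt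
    have := hd'.comp_hasDerivAt (0 : ℝ) (line_hasDerivAt x v 0)
    simpa using this.clm_apply (hasDerivAt_const (0 : ℝ) v)
  have hev : (fun t : ℝ => fderiv ℝ (Vp l u p n) (x + t • v) v) =ᶠ[𝓝 0] fun t : ℝ =>
      -((p - 1) ^ 2 / (6 * p)) * ∑ i ∈ Finset.Icc 1 n, eD l u (p - 1) n v (x + t • v) i := by
    have hc : ContinuousAt (fun t : ℝ => x + t • v) 0 := (line_hasDerivAt x v 0).continuousAt
    have : ∀ᶠ t : ℝ in 𝓝 0, x + t • v ∈ domD l u n :=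
      hc.eventually ((domD_isOpen l u n).mem_nhds (by simpa using hx))
    filter_upwards [this] with t ht
    exact fderiv_Vp hl hp ht v
  have h2 : HasDerivAt (fun t : ℝ =>
      -((p - 1) ^ 2 / (6 * p)) * ∑ i ∈ Finset.Icc 1 n, eD l u (p - 1) n v (x + t • v) i)
      (-((p - 1) ^ 2 / (6 * p)) * ∑ i ∈ Finset.Icc 1 n,
        ((p - 1 + 1) * eD l u (p - 1) n (fun j => v j ^ 2 / x j) x i
          - eR l u (p - 1) n v x i)) 0 := by
    refine HasDerivAt.const_mul _ (HasDerivAt.fun_sum fun i hi => ?_)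
    by_cases hc : i = 1 ∧ l = 0
    · simp only [eD, eR, if_pos hc]
      simpa using hasDerivAt_const (0 : ℝ) (0 : ℝ)
    · obtain ⟨ha, hab⟩ := (edge_cases hl hx hi).resolve_right hc
      simp only [eD, eR, if_neg hc, xiSeq_line, xiSeq_sq_div l u n x v]
      exact hasDerivAt_eF hq ha hab
  rw [h1.unique (h2.congr_of_eventuallyEq hev)]
  have h3 := fderiv_Vp hl hp hx (fun j => v j ^ 2 / x j)
  rw [hstat] at h3
  rw [Finset.sum_sub_distrib, ← Finset.mul_sum]
  simp only [ContinuousLinearMap.zero_apply] at h3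
  linear_combination -(p - 1 + 1) * h3

lemma eR_nonneg {l u q : ℝ} (hl : 0 ≤ l) (hq : 0 < q) {n : ℕ} {x : Fin (n - 1) → ℝ}
    (hx : x ∈ domD l u n) (v : Fin (n - 1) → ℝ) {i : ℕ} (hi : i ∈ Finset.Icc 1 n) :
    0 ≤ eR l u q n v x i := by
  by_cases hc : i = 1 ∧ l = 0
  · simp [eR, if_pos hc]
  · obtain ⟨ha, hab⟩ := (edge_cases hl hx hi).resolve_right hc
    rw [eR, if_neg hc]
    have := eFab_pos hq ha hab
    have := ha.trans hab
    positivity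

lemma sum_eR_pos {l u q : ℝ} (hl : 0 ≤ l) (hq : 0 < q) {n : ℕ} {x : Fin (n - 1) → ℝ}
    (hx : x ∈ domD l u n) (v : Fin (n - 1) → ℝ) (hv : v ≠ 0) :
    0 < ∑ i ∈ Finset.Icc 1 n, eR l u q n v x i := by
  refine (Finset.sum_nonneg fun i hi => eR_nonneg hl hq hx v hi).lt_of_ne' fun h0 => hv ?_
  rw [Finset.sum_eq_zero_iff_of_nonneg fun i hi => eR_nonneg hl hq hx v hi] at h0
  have key : ∀ k, k < n → xiSeq 0 0 n v (n - k) = 0 := by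
    intro k
    induction k with
    | zero => intro _; simp [xiSeq]
    | succ k ih =>
      intro hk
      have h1 := ih (by omega)
      have hi : n - k ∈ Finset.Icc 1 n := by rw [Finset.mem_Icc]; omega
      have h2 := h0 _ hi
      have hc : ¬ (n - k = 1 ∧ l = 0) := by omega
      obtain ⟨ha, hab⟩ := (edge_cases hl hx hi).resolve_right hc
      have hF := eFab_pos hq ha hab
      have hb := ha.trans hab
      rw [eR, if_neg hc, h1] at h2
      have h3 := ha.ne'
      have h4 := hb.ne'
      have h5 := hF.ne'
      simp only [Nat.sub_sub] at h2 h3 h5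
      simpa [h3, h4, h5] using h2
  funext j
  have := key (n - (j.1 + 1)) (by omega)
  rw [show n - (n - (j.1 + 1)) = j.1 + 1 by omega] at this
  have hj : 0 < j.1 + 1 ∧ j.1 + 1 < n := by omega
  simpa [xiSeq, hj] using this

end Helpers

/-- At any stationary point of `V_p` on `D`, the Hessian is positive definite;
in particular every stationary point is a strict local minimizer. -/
theorem hessian_posdef_at_stationary_point
    (l u : ℝ) (hl : 0 ≤ l) (hlu : l < u) (n : ℕ) (hn : 2 ≤ n) (p : ℝ) (hp : 1 < p)
    (ξ : Fin (n - 1) → ℝ) (hξ : ξ ∈ domD l u n)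
    (hstat : fderiv ℝ (Vp l u p n) ξ = 0) :
    (∀ v : Fin (n - 1) → ℝ, v ≠ 0 →
      0 < fderiv ℝ (fderiv ℝ (Vp l u p n)) ξ v v) ∧
    ∃ ε > (0 : ℝ), ∀ y : Fin (n - 1) → ℝ, y ≠ ξ → ‖y - ξ‖ < ε →
      Vp l u p n ξ < Vp l u p n y := by
  have hq : 0 < p - 1 := by linarith
  have hpos : ∀ v : Fin (n - 1) → ℝ, v ≠ 0 →
      0 < fderiv ℝ (fderiv ℝ (Vp l u p n)) ξ v v := by
    intro v hv
    rw [hess_Vp hl hp hξ hstat v]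
    have := sum_eR_pos hl hq hξ v hv
    have : 0 < p := by linarith
    positivity
  refine ⟨hpos, strict_min_of_hessian _ ξ ?_ ?_ hstat hpos⟩
  · filter_upwards [(domD_isOpen l u n).mem_nhds hξ] with y hy
    exact (Vp_contDiffAt hl hp hy).differentiableAt (by norm_num)
  · exact ((Vp_contDiffAt hl hp hξ).fderiv_right (m := 1) (by norm_num)).differentiableAt
      (by norm_num)
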